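/- (Knuth–Yao.) Let (p_i)_{i≥1} be a probability vector (p_i ≥ 0, Σ_i p_i = 1) and for each i with p_i > 0 let (b_{i,j})_{j≥1} be a binary expansion of p_i, i.e. b_{i,j} ∈ {0,1} and p_i = Σ_{j=1}^∞ b_{i,j}·2^{−j}. Then the expected number of fair bits used by the corresponding DDG-tree algorithm, namely E(T) = Σ_i Σ_{j=1}^∞ j·b_{i,j}·2^{−j}, satisfies H(p) ≤ E(T) ≤ H(p) + 2, where H(p) = Σ_i p_i·log₂(1/p_i). -/

import Mathlib

lemma ky_summ0 (c : ℕ → ℝ) (hc : ∀ j, c j = 0 ∨ c j = 1) :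
    Summable (fun j : ℕ => c j / 2 ^ (j + 1)) := by
  have h : Summable (fun j : ℕ => ((1:ℝ)/2) ^ j) := summable_geometric_two
  refine Summable.of_nonneg_of_le (fun j => ?_) (fun j => ?_) h
  · rcases hc j with h | h <;> rw [h] <;> positivity
  · rw [pow_succ, one_div, inv_pow]
    rcases hc j with h | h <;> rw [h]
    · simp
    · rw [one_div]
      gcongr
      have : (0:ℝ) < 2 ^ j := by positivity
      linarith

lemma ky_summG : Summable (fun j : ℕ => (j : ℝ) * (1/2) ^ j) := by
  simpa using summable_pow_mul_geometric_of_norm_lt_one 1 (r := (1/2 : ℝ)) (by norm_num)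

lemma ky_summ1 (c : ℕ → ℝ) (hc : ∀ j, c j = 0 ∨ c j = 1) :
    Summable (fun j : ℕ => ((j : ℝ) + 1) * c j / 2 ^ (j + 1)) := by
  have h := (summable_nat_add_iff 1).2 ky_summG
  refine Summable.of_nonneg_of_le (fun j => ?_) (fun j => ?_) h
  · rcases hc j with h | h <;> rw [h] <;> positivity
  · push_cast
    rw [one_div, inv_pow, div_eq_mul_inv]
    rcases hc j with h | h <;> rw [h]
    · simp; positivity
    · simp

lemma ky_G : HasSum (fun m : ℕ => ((m : ℝ) - 1) / 2 ^ (m + 1)) 0 := by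
  have h1 : HasSum (fun j : ℕ => (j : ℝ) * (1/2) ^ j) 2 := by
    have := hasSum_coe_mul_geometric_of_norm_lt_one (r := (1/2 : ℝ)) (by norm_num)
    norm_num at this ⊢
    exact this
  have h2 := (h1.sub hasSum_geometric_two).mul_left (1/2)
  have e : (fun m : ℕ => ((m : ℝ) - 1) / 2 ^ (m + 1)) =
      fun i : ℕ => 1 / 2 * ((i : ℝ) * (1 / 2) ^ i - (1 / 2) ^ i) := by
    funext m
    rw [one_div, inv_pow, pow_succ]
    field_simp
  rw [sub_self, mul_zero] at h2
  rw [e]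
  exact h2

lemma ky_pt (c : ℕ → ℝ) (hc : ∀ j, c j = 0 ∨ c j = 1) (q : ℝ) (hq : 0 < q)
    (he : q = ∑' j : ℕ, c j / 2 ^ (j + 1)) :
    q * Real.logb 2 (1 / q) ≤ (∑' j : ℕ, ((j : ℝ) + 1) * c j / 2 ^ (j + 1)) ∧
    (∑' j : ℕ, ((j : ℝ) + 1) * c j / 2 ^ (j + 1)) ≤ q * Real.logb 2 (1 / q) + 2 * q := by
  have s0 := ky_summ0 c hc
  have s1 := ky_summ1 c hc
  have hnn : ∀ j, 0 ≤ c j / 2 ^ (j + 1) := fun j => by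
    rcases hc j with h | h <;> rw [h] <;> positivity
  constructor
  · have : q * Real.logb 2 (1 / q) = ∑' j : ℕ, Real.logb 2 (1 / q) * (c j / 2 ^ (j + 1)) := by
      rw [tsum_mul_left, ← he, mul_comm]
    rw [this]
    refine (s0.mul_left _).tsum_le_tsum (fun j => ?_) s1
    rw [mul_div_assoc]
    rcases hc j with h | h
    · simp [h]
    · refine mul_le_mul_of_nonneg_right ?_ (hnn j)
      have hle : 1 / 2 ^ (j + 1) ≤ q := by
        have := s0.le_tsum j (fun i _ => hnn i)
        rw [← he, h] at this
        exact this
      rw [Real.logb_le_iff_le_rpow (by norm_num) (by positivity)]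
      have e : (2:ℝ) ^ ((j:ℝ) + 1) = 2 ^ (j + 1) := by
        rw [← Real.rpow_natCast]; push_cast; rfl
      rw [e, div_le_iff₀ hq]
      rwa [div_le_iff₀ (by positivity), mul_comm] at hle
  · have hex : ∃ k, c k = 1 := by
      by_contra! hne
      have : ∀ j, c j = 0 := fun j => (hc j).resolve_right (hne j)
      simp [this] at he
      exact hq.ne' he
    classical
    obtain ⟨k, hk, hlt⟩ : ∃ k, c k = 1 ∧ ∀ j < k, c j = 0 :=
      ⟨Nat.find hex, Nat.find_spec hex,
        fun j hj => (hc j).resolve_right (Nat.find_min hex hj)⟩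
    have hshift : ∀ w : ℕ → ℝ, Summable (fun j => w j * (c j / 2 ^ (j + 1))) →
        ∑' j, w j * (c j / 2 ^ (j + 1)) =
          ∑' m, w (m + k) * (c (m + k) / 2 ^ (m + k + 1)) := by
      intro w hw
      rw [← hw.sum_add_tsum_nat_add k, Finset.sum_eq_zero, zero_add]
      intro j hj
      simp [hlt j (Finset.mem_range.1 hj)]
    have hqle : q ≤ 1 / 2 ^ k := by
      have h1 := hshift (fun _ => 1) (by simpa using s0)
      simp only [one_mul] at h1
      rw [he, h1]
      have h2 : HasSum (fun m : ℕ => (1:ℝ) / 2 ^ k * (1 / 2 / 2 ^ m)) (1 / 2 ^ k * 1) :=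
        (hasSum_geometric_two' 1).mul_left _
      rw [mul_one] at h2
      rw [← h2.tsum_eq]
      refine ((summable_nat_add_iff k).2 s0).tsum_le_tsum (fun m => ?_) h2.summable
      have e : (1:ℝ) / 2 ^ k * (1 / 2 / 2 ^ m) = 1 / 2 ^ (m + k + 1) := by
        rw [pow_succ, pow_add]; field_simp
      rw [e]
      gcongr
      rcases hc (m + k) with h | h <;> rw [h]; norm_num
    have hlog : (k : ℝ) ≤ Real.logb 2 (1 / q) := by
      rw [Real.le_logb_iff_rpow_le (by norm_num) (by positivity), Real.rpow_natCast,
        le_div_iff₀ hq]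
      rwa [le_div_iff₀ (by positivity), mul_comm] at hqle
    have hkey : ∑' j : ℕ, ((j : ℝ) + 1 - (k + 2)) * (c j / 2 ^ (j + 1)) ≤ 0 := by
      have hs : Summable (fun j : ℕ => ((j : ℝ) + 1 - (k + 2)) * (c j / 2 ^ (j + 1))) := by
        refine (s1.sub (s0.mul_left ((k:ℝ) + 2))).congr (fun j => ?_)
        ring
      rw [hshift (fun j => (j : ℝ) + 1 - (k + 2)) hs]
      have h2 := ky_G.mul_left (1 / 2 ^ k)
      rw [mul_zero] at h2
      rw [← h2.tsum_eq]
      refine Summable.tsum_le_tsum (fun m => ?_) ((summable_nat_add_iff k).2 hs) h2.summable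
      have e : (1:ℝ) / 2 ^ k * (((m:ℝ) - 1) / 2 ^ (m + 1)) =
          ((m:ℝ) - 1) * (1 / 2 ^ (m + k + 1)) := by
        rw [pow_succ, pow_succ, pow_add]; field_simp
      rw [e]
      push_cast
      have e2 : (m : ℝ) + k + 1 - (k + 2) = m - 1 := by ring
      rw [e2]
      rcases Nat.eq_zero_or_pos m with h0 | h0
      · subst h0; simp [hk]
      · have : (1:ℝ) ≤ m := by exact_mod_cast h0
        refine mul_le_mul_of_nonneg_left ?_ (by linarith)
        gcongr
        rcases hc (m + k) with h | h <;> rw [h]; norm_num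
    have hsplit : ∑' j : ℕ, ((j : ℝ) + 1 - (k + 2)) * (c j / 2 ^ (j + 1)) =
        (∑' j : ℕ, ((j : ℝ) + 1) * c j / 2 ^ (j + 1)) - (k + 2) * q := by
      conv_rhs => rw [he]
      rw [← tsum_mul_left, ← s1.tsum_sub (s0.mul_left ((k:ℝ) + 2))]
      congr 1; funext j; ring
    rw [hsplit] at hkey
    nlinarith [mul_le_mul_of_nonneg_left hlog hq.le]

/-- Knuth–Yao: For a probability vector `(p_i)` with binary expansions
`p_i = Σ_j b_{i,j} 2^{−j}` (digits in {0,1}), the expected number of fair bits of the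
DDG-tree algorithm, `E(T) = Σ_i Σ_j j·b_{i,j}·2^{−j}`, satisfies
`H(p) ≤ E(T) ≤ H(p) + 2` where `H(p) = Σ_i p_i log₂(1/p_i)`. -/
theorem knuth_yao_bounds
    (p : ℕ → ℝ) (hpnn : ∀ i, 0 ≤ p i) (hpsum : HasSum p 1)
    (b : ℕ → ℕ → ℝ) (hb : ∀ i j, b i j = 0 ∨ b i j = 1)
    (hexp : ∀ i, 0 < p i → p i = ∑' j : ℕ, b i j / 2 ^ (j + 1))
    (hzero : ∀ i, p i = 0 → ∀ j, b i j = 0) :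
    (∑' i : ℕ, p i * Real.logb 2 (1 / p i))
        ≤ (∑' i : ℕ, ∑' j : ℕ, ((j : ℝ) + 1) * b i j / 2 ^ (j + 1)) ∧
      (∑' i : ℕ, ∑' j : ℕ, ((j : ℝ) + 1) * b i j / 2 ^ (j + 1))
        ≤ (∑' i : ℕ, p i * Real.logb 2 (1 / p i)) + 2 := by
  have hp : ∀ i, p i * Real.logb 2 (1 / p i) ≤
        (∑' j : ℕ, ((j : ℝ) + 1) * b i j / 2 ^ (j + 1)) ∧
      (∑' j : ℕ, ((j : ℝ) + 1) * b i j / 2 ^ (j + 1)) ≤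
        p i * Real.logb 2 (1 / p i) + 2 * p i := by
    intro i
    rcases (hpnn i).eq_or_lt with h | h
    · simp [hzero i h.symm, ← h]
    · exact ky_pt (b i) (hb i) (p i) h (hexp i h)
  have hH : ∀ i, 0 ≤ p i * Real.logb 2 (1 / p i) := by
    intro i
    rcases (hpnn i).eq_or_lt with h | h
    · simp [← h]
    · refine mul_nonneg h.le (Real.logb_nonneg (by norm_num) ?_)
      rw [le_div_iff₀ h, one_mul]
      exact le_hasSum hpsum i (fun j _ => hpnn j)
  have hp2 : HasSum (fun i => 2 * p i) 2 := by simpa using hpsum.mul_left 2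
  by_cases hs : Summable (fun i => p i * Real.logb 2 (1 / p i))
  · have hs2 := Summable.of_nonneg_of_le (fun i => (hH i).trans (hp i).1)
      (fun i => (hp i).2) (hs.add hp2.summable)
    refine ⟨hs.tsum_le_tsum (fun i => (hp i).1) hs2, ?_⟩
    have h3 := hs2.tsum_le_tsum (fun i => (hp i).2) (hs.add hp2.summable)
    rwa [hs.tsum_add hp2.summable, hp2.tsum_eq] at h3
  · have hs2 : ¬ Summable (fun i => ∑' j : ℕ, ((j : ℝ) + 1) * b i j / 2 ^ (j + 1)) :=
      fun h => hs (Summable.of_nonneg_of_le hH (fun i => (hp i).1) h)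
    rw [tsum_eq_zero_of_not_summable hs, tsum_eq_zero_of_not_summable hs2]
    norm_num
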